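/- Let P be a submonoid of a group G, let p₁, q₁, …, p_n, q_n ∈ P, set W = V_{p₁}* V_{q₁} ⋯ V_{p_n}* V_{q_n} (a bounded operator on ℓ²(P)) and g = p₁⁻¹q₁ ⋯ p_n⁻¹q_n ∈ G. Then J ∘ W = λ_g ∘ J ∘ (W* W) as operators from ℓ²(P) to ℓ²(G), where J : ℓ²(P) → ℓ²(G) is the canonical inclusion isometry with J δ_s = δ_s and λ_g is the left translation unitary on ℓ²(G). -/

import Mathlib

noncomputable section

open ContinuousLinearMap
open scoped Classical

variable {G : Type*} [Group G]

/-- The Hilbert space ℓ²(P). -/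
abbrev l2 (P : Submonoid G) : Type _ := lp (fun _ : P => ℂ) 2

/-- The standard orthonormal basis vector δ_s of ℓ²(P). -/
def delta (P : Submonoid G) (s : P) : l2 P :=
  letI := Classical.decEq P
  lp.single 2 s 1

/-- The set pX = {px : x ∈ X}. -/
def lmul (P : Submonoid G) (p : P) (X : Set P) : Set P := (fun x => p * x) '' X

/-- The set p⁻¹X = {y ∈ P : py ∈ X}. -/
def linv (P : Submonoid G) (p : P) (X : Set P) : Set P := {y : P | p * y ∈ X}

/-- The set p₁⁻¹q₁ ⋯ pₙ⁻¹qₙ X, the operations being applied iteratively from the right;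
the word is encoded as the list [(p₁,q₁),…,(pₙ,qₙ)]. -/
def wordSet (P : Submonoid G) (l : List (P × P)) (X : Set P) : Set P :=
  l.foldr (fun a Y => linv P a.1 (lmul P a.2 Y)) X

/-- The operator V_{p₁}* V_{q₁} ⋯ V_{pₙ}* V_{qₙ} on ℓ²(P), the word being encoded as the
list [(p₁,q₁),…,(pₙ,qₙ)]. -/
def opWord (P : Submonoid G) (V : P → (l2 P →L[ℂ] l2 P)) (l : List (P × P)) :
    l2 P →L[ℂ] l2 P :=
  (l.map fun a => (ContinuousLinearMap.adjoint (V a.1)) * (V a.2)).prod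

/-- The group element p₁⁻¹q₁ ⋯ pₙ⁻¹qₙ of G. -/
def grpWord (P : Submonoid G) (l : List (P × P)) : G :=
  (l.map fun a => ((a.1 : G))⁻¹ * (a.2 : G)).prod


/-- The standard orthonormal basis vector δ_h of ℓ²(G). -/
def deltaG (G : Type*) [Group G] (h : G) : lp (fun _ : G => ℂ) 2 :=
  letI := Classical.decEq G
  lp.single 2 h 1

theorem inner_delta_left (P : Submonoid G) (s : P) (f : l2 P) :
    inner ℂ (delta P s) f = f s := by
  simp [delta, lp.inner_single_left]

theorem delta_apply (P : Submonoid G) (s r : P) :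
    delta P s r = if r = s then 1 else 0 := by
  simp [delta, Pi.single_apply]

theorem l2_ext_inner_delta {P : Submonoid G} {f g : l2 P}
    (h : ∀ s : P, inner ℂ (delta P s) f = inner ℂ (delta P s) g) : f = g := by
  ext s
  simpa only [inner_delta_left] using h s

theorem clm_ext_delta {P : Submonoid G} {E : Type*} [NormedAddCommGroup E]
    [NormedSpace ℂ E] {S T : l2 P →L[ℂ] E}
    (h : ∀ s : P, S (delta P s) = T (delta P s)) : S = T := by
  let := Classical.decEq P
  refine lp.ext_continuousLinearMap (by norm_num) fun s => ?_
  ext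
  simpa [delta] using h s

/-- The adjoint of a translation isometry acts on basis vectors as a partial left inverse. -/
theorem adjoint_translation_delta (P : Submonoid G) (V : P → (l2 P →L[ℂ] l2 P))
    (hV : ∀ p s : P, V p (delta P s) = delta P (p * s)) (p s : P) :
    adjoint (V p) (delta P s) = 0 ∨
      ∃ t : P, p * t = s ∧ adjoint (V p) (delta P s) = delta P t := by
  by_cases h : ∃ t : P, p * t = s
  · obtain ⟨t, rfl⟩ := h
    refine Or.inr ⟨t, rfl, l2_ext_inner_delta fun r => ?_⟩
    rw [adjoint_inner_right, hV, inner_delta_left, inner_delta_left, delta_apply, delta_apply]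
    simp
  · refine Or.inl (l2_ext_inner_delta fun r => ?_)
    rw [adjoint_inner_right, hV, inner_delta_left, delta_apply, inner_zero_right,
      if_neg fun hr => h ⟨r, hr⟩]

/-- A word operator sends a basis vector either to zero or to its translate by the
corresponding group element. -/
theorem opWord_delta (P : Submonoid G) (V : P → (l2 P →L[ℂ] l2 P))
    (hV : ∀ p s : P, V p (delta P s) = delta P (p * s)) (l : List (P × P)) (s : P) :
    opWord P V l (delta P s) = 0 ∨
      ∃ t : P, (t : G) = grpWord P l * s ∧ opWord P V l (delta P s) = delta P t := by
  induction l with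
  | nil => exact Or.inr ⟨s, by simp [grpWord], by simp [opWord]⟩
  | cons a l ih =>
    have hop : opWord P V (a :: l) (delta P s) =
        adjoint (V a.1) (V a.2 (opWord P V l (delta P s))) := by
      simp [opWord]
    have hgrp : grpWord P (a :: l) = (a.1 : G)⁻¹ * a.2 * grpWord P l := by
      simp [grpWord]
    rw [hop, hgrp]
    rcases ih with h | ⟨t, ht, h⟩
    · simp [h]
    · rw [h, hV]
      refine (adjoint_translation_delta P V hV a.1 (a.2 * t)).imp_right ?_
      rintro ⟨u, hu, hu'⟩
      refine ⟨u, ?_, hu'⟩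
      have hG : (a.1 : G) * u = a.2 * t := by exact_mod_cast congrArg Subtype.val hu
      rw [mul_assoc, mul_assoc, ← ht, ← hG, inv_mul_cancel_left]

/-- The initial projection of a word operator fixes every basis vector outside its kernel. -/
theorem adjoint_opWord_opWord_delta (P : Submonoid G) (V : P → (l2 P →L[ℂ] l2 P))
    (hV : ∀ p s : P, V p (delta P s) = delta P (p * s)) (l : List (P × P)) (s : P)
    (hs : opWord P V l (delta P s) ≠ 0) :
    adjoint (opWord P V l) (opWord P V l (delta P s)) = delta P s := by
  obtain ⟨t, ht, h⟩ := (opWord_delta P V hV l s).resolve_left hs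
  refine l2_ext_inner_delta fun r => ?_
  rw [adjoint_inner_right, inner_delta_left, delta_apply]
  rcases opWord_delta P V hV l r with hr | ⟨u, hu, hr⟩
  · rw [hr, inner_zero_left, if_neg]
    rintro rfl
    exact hs hr
  · rw [hr, h, inner_delta_left, delta_apply]
    have : u = t ↔ r = s := by
      rw [← Subtype.coe_inj, ht, hu, mul_right_inj, Subtype.coe_inj]
    simp only [this]

/-- For W = V_{p₁}* V_{q₁} ⋯ V_{pₙ}* V_{qₙ} and g = p₁⁻¹q₁ ⋯ pₙ⁻¹qₙ ∈ G one has
J ∘ W = λ_g ∘ J ∘ (W* W), where J : ℓ²(P) → ℓ²(G) is the canonical inclusion isometry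
and λ_g the left translation unitary on ℓ²(G). -/
theorem stmt16 (P : Submonoid G)
    (V : P → (l2 P →L[ℂ] l2 P))
    (hV : ∀ p s : P, V p (delta P s) = delta P (p * s))
    (J : l2 P →L[ℂ] lp (fun _ : G => ℂ) 2)
    (hJ : ∀ s : P, J (delta P s) = deltaG G (s : G))
    (lam : G → (lp (fun _ : G => ℂ) 2 →L[ℂ] lp (fun _ : G => ℂ) 2))
    (hlam : ∀ g h : G, lam g (deltaG G h) = deltaG G (g * h))
    (n : ℕ) (p q : Fin n → P) :
    J.comp (opWord P V (List.ofFn fun i => (p i, q i)))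
      = ((lam (grpWord P (List.ofFn fun i => (p i, q i)))).comp J).comp
          (ContinuousLinearMap.adjoint (opWord P V (List.ofFn fun i => (p i, q i))) *
            opWord P V (List.ofFn fun i => (p i, q i))) := by
  set l := List.ofFn fun i => (p i, q i)
  refine clm_ext_delta fun s => ?_
  simp only [mul_def, comp_apply]
  by_cases hs : opWord P V l (delta P s) = 0
  · simp [hs]
  · rw [adjoint_opWord_opWord_delta P V hV l s hs]
    obtain ⟨t, ht, h⟩ := (opWord_delta P V hV l s).resolve_left hs
    rw [h, hJ, hJ, hlam, ht]
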